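/- (SW-identity) The union of the layered Slepian-Wolf regions over all ordered partitions of V equals the joint Slepian-Wolf region: ⋃_{C ∈ F_V} R_C = R_SW, where R_SW = {R ∈ ℝ^V : R_S ≥ H(X_S Y_S | X_{S^c} Y_{S^c} Z) for all S ⊆ V} and R_C = {R : R_S ≥ Σ_{i=1}^{K+1} H(X_{S∩L_i} Y_{S∩L_{i−1}} | X_{L_i∖S} Y_{L_{i−1}∖S} X_{L^i} Y_{L^{i−1}} Z) for all S ⊆ V}. -/

import Mathlib

open Finset in
/-- Probability that the discrete random variable `X` takes the value `a`,
under the weight function `p` on the finite sample space `Ω`. -/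
noncomputable def pr {Ω : Type*} [Fintype Ω] {α : Type*} [DecidableEq α]
    (p : Ω → ℝ) (X : Ω → α) (a : α) : ℝ :=
  ∑ ω ∈ univ.filter (fun ω => X ω = a), p ω

/-- Shannon entropy (base 2) of a discrete random variable. (`0·log 0 = 0` since `logb 2 0 = 0`.) -/
noncomputable def ent {Ω : Type*} [Fintype Ω] {α : Type*} [Fintype α] [DecidableEq α]
    (p : Ω → ℝ) (X : Ω → α) : ℝ :=
  -∑ a : α, pr p X a * Real.logb 2 (pr p X a)

/-- Conditional Shannon entropy `H(X|Z) = H(X,Z) − H(Z)`. -/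
noncomputable def cent {Ω α β : Type*} [Fintype Ω] [Fintype α] [DecidableEq α]
    [Fintype β] [DecidableEq β] (p : Ω → ℝ) (X : Ω → α) (Z : Ω → β) : ℝ :=
  ent p (fun ω => (X ω, Z ω)) - ent p Z

/-- The tuple `X_S = (X_v : v ∈ S)` of a family of random variables, encoded with
`Option`: coordinates outside `S` are masked to `none`. -/
def mask {Ω V : Type*} [DecidableEq V] {α : V → Type*}
    (X : ∀ v, Ω → α v) (S : Finset V) : Ω → ∀ v, Option (α v) :=
  fun ω v => if v ∈ S then some (X v ω) else none

open Finset

/-- Layered conditional entropy term: `H(X_{AX} Y_{AY} | X_{BX} Y_{BY} Z)`, for families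
of discrete random variables `(X_v, Y_v : v ∈ V)` and side information `Z`. -/
noncomputable def ce {Ω V γ : Type*} [Fintype Ω] [Fintype V] [DecidableEq V]
    {α β : V → Type*} [∀ v, Fintype (α v)] [∀ v, DecidableEq (α v)]
    [∀ v, Fintype (β v)] [∀ v, DecidableEq (β v)] [Fintype γ] [DecidableEq γ]
    (p : Ω → ℝ) (X : ∀ v, Ω → α v) (Y : ∀ v, Ω → β v) (Z : Ω → γ)
    (AX AY BX BY : Finset V) : ℝ :=
  cent p (fun ω => (mask X AX ω, mask Y AY ω))
    (fun ω => (mask X BX ω, mask Y BY ω, Z ω))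

/-- `L^i = ∪_{k<i} L_k`, the union of the layers below layer `i`. -/
def lowUnion {V : Type*} [DecidableEq V] (L : ℕ → Finset V) (i : ℕ) : Finset V :=
  (Finset.range i).biUnion L

/-- `[L 1, …, L K]` is an ordered partition of `V` (with conventions `L 0 = ∅` and
`L i = ∅` for `i > K`). -/
def IsOrdPart {V : Type*} [Fintype V] [DecidableEq V] (K : ℕ) (L : ℕ → Finset V) : Prop :=
  (∀ i, 1 ≤ i → i ≤ K → (L i).Nonempty) ∧
  (∀ i, i = 0 ∨ K < i → L i = ∅) ∧
  (∀ i j, i ≠ j → Disjoint (L i) (L j)) ∧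
  (Finset.range (K + 1)).biUnion L = Finset.univ

/-- `h_C(S) = Σ_{i=1}^{K+1} H(X_{S∩L_i} Y_{S∩L_{i−1}} | X_{L^i} Y_{L^{i−1}} Z)`. -/
noncomputable def layerEnt {Ω V γ : Type*} [Fintype Ω] [Fintype V] [DecidableEq V]
    {α β : V → Type*} [∀ v, Fintype (α v)] [∀ v, DecidableEq (α v)]
    [∀ v, Fintype (β v)] [∀ v, DecidableEq (β v)] [Fintype γ] [DecidableEq γ]
    (p : Ω → ℝ) (X : ∀ v, Ω → α v) (Y : ∀ v, Ω → β v) (Z : Ω → γ)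
    (K : ℕ) (L : ℕ → Finset V) (S : Finset V) : ℝ :=
  ∑ i ∈ Finset.Icc 1 (K + 1),
    ce p X Y Z (S ∩ L i) (S ∩ L (i - 1)) (lowUnion L i) (lowUnion L (i - 1))

/-- `h_C(S|Sᶜ)`-style layered sum:
`Σ_{i=1}^{K+1} H(X_{S∩L_i} Y_{S∩L_{i−1}} | X_{L_i∖S} Y_{L_{i−1}∖S} X_{L^i} Y_{L^{i−1}} Z)`. -/
noncomputable def layerCondEnt {Ω V γ : Type*} [Fintype Ω] [Fintype V] [DecidableEq V]
    {α β : V → Type*} [∀ v, Fintype (α v)] [∀ v, DecidableEq (α v)]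
    [∀ v, Fintype (β v)] [∀ v, DecidableEq (β v)] [Fintype γ] [DecidableEq γ]
    (p : Ω → ℝ) (X : ∀ v, Ω → α v) (Y : ∀ v, Ω → β v) (Z : Ω → γ)
    (K : ℕ) (L : ℕ → Finset V) (S : Finset V) : ℝ :=
  ∑ i ∈ Finset.Icc 1 (K + 1),
    ce p X Y Z (S ∩ L i) (S ∩ L (i - 1))
      ((L i \ S) ∪ lowUnion L i) ((L (i - 1) \ S) ∪ lowUnion L (i - 1))

section Entropy

variable {Ω : Type*} [Fintype Ω] {α β γ : Type*} [Fintype α] [DecidableEq α]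
  [Fintype β] [DecidableEq β] [Fintype γ] [DecidableEq γ]

theorem sum_pr_mul (p : Ω → ℝ) (U : Ω → α) (g : α → ℝ) :
    ∑ a, pr p U a * g a = ∑ ω, p ω * g (U ω) := by
  have h : ∀ a, pr p U a * g a = ∑ ω ∈ univ.filter (fun ω => U ω = a), p ω * g (U ω) := by
    intro a
    rw [pr, Finset.sum_mul]
    refine Finset.sum_congr rfl fun ω hω => ?_
    rw [(Finset.mem_filter.1 hω).2]
  simp_rw [h]
  exact Finset.sum_fiberwise univ U _

theorem sum_pr (p : Ω → ℝ) (U : Ω → α) : ∑ a, pr p U a = ∑ ω, p ω := by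
  simpa using sum_pr_mul p U (fun _ => 1)

theorem ent_eq_sum (p : Ω → ℝ) (U : Ω → α) :
    ent p U = -∑ ω, p ω * Real.logb 2 (pr p U (U ω)) := by
  rw [ent, sum_pr_mul p U (fun a => Real.logb 2 (pr p U a))]

/-- Entropy depends only on the partition of the sample space induced by the variable. -/
theorem ent_congr (p : Ω → ℝ) (U : Ω → α) (W : Ω → β)
    (h : ∀ ω ω', U ω = U ω' ↔ W ω = W ω') : ent p U = ent p W := by
  rw [ent_eq_sum, ent_eq_sum]
  have : ∀ ω, pr p U (U ω) = pr p W (W ω) := by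
    intro ω
    simp only [pr, h]
  simp only [this]

theorem pr_nonneg {α : Type*} [DecidableEq α] {p : Ω → ℝ} (hp : ∀ ω, 0 ≤ p ω) (U : Ω → α) (a : α) : 0 ≤ pr p U a :=
  Finset.sum_nonneg fun ω _ => hp ω

theorem pr_pos {α : Type*} [DecidableEq α] {p : Ω → ℝ} (hp : ∀ ω, 0 ≤ p ω) (U : Ω → α) {ω : Ω} (hω : 0 < p ω) :
    0 < pr p U (U ω) :=
  hω.trans_le (Finset.single_le_sum (f := p) (fun ω _ => hp ω) (by simp))

theorem sum_pr_pair {β : Type*} [DecidableEq β] (p : Ω → ℝ) (U : Ω → α) (W : Ω → β) (w : β) :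
    ∑ u, pr p (fun ω => (U ω, W ω)) (u, w) = pr p W w := by
  simp only [pr, Prod.mk.injEq]
  rw [← Finset.sum_fiberwise (univ.filter fun ω => W ω = w) U p]
  refine Finset.sum_congr rfl fun u _ => ?_
  rw [Finset.filter_filter]
  refine Finset.sum_congr (Finset.filter_congr fun ω _ => and_comm) fun _ _ => rfl

theorem logb_ge_one_sub_inv {x : ℝ} (hx : 0 < x) : (1 - x⁻¹) / Real.log 2 ≤ Real.logb 2 x := by
  rw [Real.logb]
  exact div_le_div_of_nonneg_right (Real.one_sub_inv_le_log_of_pos hx)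
    (Real.log_pos one_lt_two).le

/-- Nonnegativity of conditional mutual information. -/
theorem ent_strong_subadditivity {p : Ω → ℝ} (hp : ∀ ω, 0 ≤ p ω)
    (U : Ω → α) (T : Ω → β) (W : Ω → γ) :
    ent p (fun ω => (U ω, T ω, W ω)) + ent p W ≤
      ent p (fun ω => (U ω, W ω)) + ent p (fun ω => (T ω, W ω)) := by
  set q : α × β × γ → ℝ := pr p (fun ω => (U ω, T ω, W ω)) with hq
  set q₁ : α × γ → ℝ := pr p (fun ω => (U ω, W ω)) with hq₁
  set q₂ : β × γ → ℝ := pr p (fun ω => (T ω, W ω)) with hq₂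
  set r : γ → ℝ := pr p W with hr
  let g : α × β × γ → ℝ := fun x =>
    q₁ (x.1, x.2.2) * q₂ (x.2.1, x.2.2) / (q x * r x.2.2)
  have key : ∀ ω, p ω * ((1 - g (U ω, T ω, W ω)) / Real.log 2) ≤
      p ω * Real.logb 2 (q (U ω, T ω, W ω)) + p ω * Real.logb 2 (r (W ω))
        - p ω * Real.logb 2 (q₁ (U ω, W ω)) - p ω * Real.logb 2 (q₂ (T ω, W ω)) := by
    intro ω
    rcases (hp ω).eq_or_lt with h0 | h0
    · simp [← h0]
    have h1 : 0 < q (U ω, T ω, W ω) := pr_pos hp (fun ω => (U ω, T ω, W ω)) h0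
    have h2 : 0 < q₁ (U ω, W ω) := pr_pos hp (fun ω => (U ω, W ω)) h0
    have h3 : 0 < q₂ (T ω, W ω) := pr_pos hp (fun ω => (T ω, W ω)) h0
    have h4 : 0 < r (W ω) := pr_pos hp W h0
    have h5 := logb_ge_one_sub_inv (div_pos (mul_pos h1 h4) (mul_pos h2 h3))
    rw [Real.logb_div (by positivity) (by positivity), Real.logb_mul h1.ne' h4.ne',
      Real.logb_mul h2.ne' h3.ne', inv_div] at h5
    have := mul_le_mul_of_nonneg_left h5 (hp ω)
    simp only [g]
    linarith
  have hg : ∑ ω, p ω * g (U ω, T ω, W ω) ≤ ∑ ω, p ω := by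
    rw [← sum_pr_mul p (fun ω => (U ω, T ω, W ω)) g, ← sum_pr p W]
    have hle : ∀ x : α × β × γ, q x * g x ≤ q₁ (x.1, x.2.2) * q₂ (x.2.1, x.2.2) / r x.2.2 := by
      intro x
      have h2 : 0 ≤ q₁ (x.1, x.2.2) := pr_nonneg hp _ _
      have h3 : 0 ≤ q₂ (x.2.1, x.2.2) := pr_nonneg hp _ _
      have h4 : 0 ≤ r x.2.2 := pr_nonneg hp _ _
      rcases eq_or_ne (q x) 0 with h | h
      · rw [h, zero_mul]; positivity
      · apply le_of_eq
        simp only [g]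
        rw [← mul_div_assoc, mul_div_mul_left _ _ h]
    refine (Finset.sum_le_sum fun x _ => hle x).trans (le_of_eq ?_)
    rw [Fintype.sum_prod_type, Finset.sum_congr rfl fun a _ => Fintype.sum_prod_type _]
    simp only
    rw [Finset.sum_congr rfl fun a _ => Finset.sum_comm, Finset.sum_comm]
    refine Finset.sum_congr rfl fun w _ => ?_
    simp_rw [← Finset.sum_div, ← Finset.mul_sum, ← Finset.sum_mul]
    rw [hq₁, hq₂, sum_pr_pair, sum_pr_pair, ← hr, mul_self_div_self]
  have hsum := Finset.sum_le_sum fun ω (_ : ω ∈ univ) => key ω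
  simp only [Finset.sum_sub_distrib, Finset.sum_add_distrib] at hsum
  have hpos : 0 ≤ ∑ ω, p ω * ((1 - g (U ω, T ω, W ω)) / Real.log 2) := by
    simp_rw [← mul_div_assoc, ← Finset.sum_div, mul_sub, mul_one, Finset.sum_sub_distrib]
    exact div_nonneg (sub_nonneg.2 hg) (Real.log_pos one_lt_two).le
  simp only [ent_eq_sum]
  linarith

end Entropy

section JointEntropy

variable {Ω V γ : Type*} [Fintype Ω] [Fintype V] [DecidableEq V]
  {α β : V → Type*} [∀ v, Fintype (α v)] [∀ v, DecidableEq (α v)]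
  [∀ v, Fintype (β v)] [∀ v, DecidableEq (β v)] [Fintype γ] [DecidableEq γ]

theorem mask_eq_iff {Ω V : Type*} [DecidableEq V] {α : V → Type*} (X : ∀ v, Ω → α v)
    (S : Finset V) (ω ω' : Ω) :
    mask X S ω = mask X S ω' ↔ ∀ v ∈ S, X v ω = X v ω' := by
  simp only [mask, funext_iff]
  refine forall_congr' fun v => ?_
  by_cases h : v ∈ S <;> simp [h]

/-- The joint entropy `H(X_A Y_B Z)`. -/
noncomputable def jointEnt (p : Ω → ℝ) (X : ∀ v, Ω → α v) (Y : ∀ v, Ω → β v) (Z : Ω → γ)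
    (A B : Finset V) : ℝ :=
  ent p (fun ω => (mask X A ω, mask Y B ω, Z ω))

set_option synthInstance.maxSize 1000 in
set_option synthInstance.maxHeartbeats 400000 in
theorem ce_eq_jointEnt_sub (p : Ω → ℝ) (X : ∀ v, Ω → α v) (Y : ∀ v, Ω → β v) (Z : Ω → γ)
    (A B A' B' : Finset V) :
    ce p X Y Z A B A' B' =
      jointEnt p X Y Z (A ∪ A') (B ∪ B') - jointEnt p X Y Z A' B' := by
  rw [ce, cent, jointEnt, jointEnt]
  congr 1
  apply ent_congr
  intro ω ω'
  simp only [Prod.mk.injEq, mask_eq_iff, Finset.mem_union, or_imp, forall_and]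
  tauto

set_option synthInstance.maxSize 1000 in
set_option synthInstance.maxHeartbeats 400000 in
theorem jointEnt_submodular {p : Ω → ℝ} (hp : ∀ ω, 0 ≤ p ω) (X : ∀ v, Ω → α v)
    (Y : ∀ v, Ω → β v) (Z : Ω → γ) (A A' B B' : Finset V) :
    jointEnt p X Y Z (A ∪ A') (B ∪ B') + jointEnt p X Y Z (A ∩ A') (B ∩ B') ≤
      jointEnt p X Y Z A B + jointEnt p X Y Z A' B' := by
  have h := ent_strong_subadditivity hp (fun ω => (mask X A ω, mask Y B ω))
    (fun ω => (mask X A' ω, mask Y B' ω))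
    (fun ω => (mask X (A ∩ A') ω, mask Y (B ∩ B') ω, Z ω))
  convert h using 2
  all_goals
    apply ent_congr
    intro ω ω'
    simp only [Prod.mk.injEq, mask_eq_iff] <;> grind

end JointEntropy

section Delay

variable {V : Type*} [Fintype V] [DecidableEq V]

/-- The elements whose delay is below `i`, together with those of `S` whose delay is `i`. -/
def revealed (d : V → ℕ) (i : ℕ) (S : Finset V) : Finset V :=
  univ.filter fun v => d v < i ∨ d v = i ∧ v ∈ S

theorem mem_revealed {d : V → ℕ} {i : ℕ} {S : Finset V} {v : V} :
    v ∈ revealed d i S ↔ d v < i ∨ d v = i ∧ v ∈ S := by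
  simp [revealed]

/-- The value of `f` at stage `i`, when the first coordinate of `v` is revealed at stage `d v`
and the second one at stage `d v + 1`. -/
def stageValue (f : Finset V → Finset V → ℝ) (d : V → ℕ) (i : ℕ) (S : Finset V) : ℝ :=
  f (revealed d i S) (revealed (fun v => d v + 1) i S)

/-- The total increment of `f` over the first `N` stages, when at each stage only the
elements of `S` are revealed on top of the previous stages. -/
def stageGain (f : Finset V → Finset V → ℝ) (d : V → ℕ) (N : ℕ) (S : Finset V) : ℝ :=
  ∑ i ∈ range N, (stageValue f d i S - stageValue f d i ∅)

/-- The total increment of `f` over all stages. -/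
def delayGain (f : Finset V → Finset V → ℝ) (d : V → ℕ) (S : Finset V) : ℝ :=
  stageGain f d (univ.sup d + 2) S

/-- Submodularity of a function of two sets. -/
def Submodular₂ (f : Finset V → Finset V → ℝ) : Prop :=
  ∀ A A' B B', f (A ∪ A') (B ∪ B') + f (A ∩ A') (B ∩ B') ≤ f A B + f A' B'

variable {f : Finset V → Finset V → ℝ}

theorem stageGain_congr {d : V → ℕ} {N M : ℕ} (hN : ∀ v, d v + 2 ≤ N) (hM : ∀ v, d v + 2 ≤ M)
    (S : Finset V) : stageGain f d N S = stageGain f d M S := by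
  wlog h : N ≤ M generalizing N M
  · exact (this hM hN (le_of_not_ge h)).symm
  refine Finset.sum_subset (Finset.range_subset_range.2 h) fun i _ hi => ?_
  have hi' : ∀ v, d v + 2 ≤ i := fun v => (hN v).trans (by simpa using hi)
  have : stageValue f d i S = stageValue f d i ∅ := by
    unfold stageValue
    congr 1 <;> ext v <;> simp only [mem_revealed] <;> have := hi' v <;> grind
  rw [this, sub_self]

theorem delay_le_sup {V : Type*} [Fintype V] (d : V → ℕ) (v : V) : d v ≤ univ.sup d := Finset.le_sup (mem_univ v)

theorem delayGain_eq_stageGain {d : V → ℕ} {N : ℕ} (hN : ∀ v, d v + 2 ≤ N) (S : Finset V) :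
    delayGain f d S = stageGain f d N S :=
  stageGain_congr (fun v => Nat.add_le_add_right (delay_le_sup d v) 2) hN S

theorem stageGain_shift_ge (hf : Submodular₂ f) (d : V → ℕ) (T S : Finset V) (N : ℕ) :
    stageGain f d (N + 1) (S ∩ T) + stageGain f d N (S ∪ T) - stageGain f d N T ≤
      stageGain f (fun v => if v ∈ T then d v else d v + 1) (N + 1) S := by
  set d' : V → ℕ := fun v => if v ∈ T then d v else d v + 1 with hd'
  have h0 : stageValue f d' 0 S - stageValue f d' 0 ∅ =
      stageValue f d 0 (S ∩ T) - stageValue f d 0 ∅ := by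
    unfold stageValue
    congr 2 <;> ext v <;> simp only [mem_revealed, hd'] <;> grind
  have h1 : ∀ i, stageValue f d' (i + 1) ∅ = stageValue f d i T := by
    intro i
    unfold stageValue
    congr 1 <;> ext v <;> simp only [mem_revealed, hd'] <;> grind
  have h2 : ∀ i, stageValue f d (i + 1) (S ∩ T) + stageValue f d i (S ∪ T) ≤
      stageValue f d' (i + 1) S + stageValue f d (i + 1) ∅ := by
    intro i
    refine le_trans (le_of_eq ?_) (hf _ _ _ _)
    unfold stageValue
    congr 2 <;> ext v <;> simp only [mem_revealed, hd', mem_union, mem_inter] <;> grind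
  have h3 := Finset.sum_le_sum fun i (_ : i ∈ range N) => h2 i
  simp only [Finset.sum_add_distrib] at h3
  simp only [stageGain, Finset.sum_range_succ' _ N, h0, h1, Finset.sum_sub_distrib]
  linarith

theorem delayGain_shift_ge (hf : Submodular₂ f) (d : V → ℕ) (T S : Finset V) :
    delayGain f d (S ∩ T) + delayGain f d (S ∪ T) - delayGain f d T ≤
      delayGain f (fun v => if v ∈ T then d v else d v + 1) S := by
  have hd := delay_le_sup d
  have h := stageGain_shift_ge hf d T S (univ.sup d + 2)
  rw [← delayGain_eq_stageGain, ← delayGain_eq_stageGain, ← delayGain_eq_stageGain,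
    ← delayGain_eq_stageGain] at h
  · exact h
  all_goals intro v; have := hd v; grind

theorem delayGain_add_one (d : V → ℕ) (S : Finset V) :
    delayGain f (fun v => d v + 1) S = delayGain f d S := by
  have hd := delay_le_sup d
  rw [delayGain_eq_stageGain (N := univ.sup d + 2 + 1) (fun v => by have := hd v; omega),
    delayGain_eq_stageGain (N := univ.sup d + 2) (fun v => by have := hd v; omega)]
  have h0 : stageValue f (fun v => d v + 1) 0 S = stageValue f (fun v => d v + 1) 0 ∅ := by
    unfold stageValue
    congr 1
  have h1 : ∀ i S, stageValue f (fun v => d v + 1) (i + 1) S = stageValue f d i S := by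
    intro i S
    simp [stageValue, revealed]
  simp only [stageGain, Finset.sum_range_succ' _ (univ.sup d + 2), h0, h1, sub_self, add_zero]

/-- If `T` is finished strictly before its complement starts, its gain is the joint one. -/
theorem delayGain_of_separated {d : V → ℕ} {T : Finset V} (m : ℕ) (hT : ∀ v ∈ T, d v + 1 < m)
    (hT' : ∀ v ∉ T, m < d v) : delayGain f d T = f T T - f ∅ ∅ := by
  have hd := delay_le_sup d
  have hstep : ∀ i, stageValue f d i T - stageValue f d i ∅ =
      stageValue f d (min (i + 1) m) ∅ - stageValue f d (min i m) ∅ := by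
    intro i
    rcases lt_or_ge i m with h | h
    · rw [min_eq_left h, min_eq_left h.le]
      unfold stageValue
      congr 2 <;> ext v <;> simp only [mem_revealed] <;> have := hT v <;> have := hT' v <;> grind
    · rw [min_eq_right h, min_eq_right (by omega), sub_self, sub_eq_zero]
      unfold stageValue
      congr 1 <;> ext v <;> simp only [mem_revealed] <;> have := hT v <;> have := hT' v <;> grind
  rw [delayGain_eq_stageGain (N := univ.sup d + 2 + m) (fun v => by have := hd v; omega),
    stageGain, Finset.sum_congr rfl fun i _ => hstep i,
    Finset.sum_range_sub (fun i => stageValue f d (min i m) ∅),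
    min_eq_right (by omega), min_eq_left (by omega)]
  unfold stageValue
  congr 2 <;> ext v <;> simp only [mem_revealed] <;> have := hT v <;> have := hT' v <;> grind

theorem delayGain_univ (d : V → ℕ) : delayGain f d univ = f univ univ - f ∅ ∅ :=
  delayGain_of_separated (univ.sup d + 2)
    (fun v _ => by have := delay_le_sup d v; omega) (fun v hv => absurd (mem_univ v) hv)

theorem delayGain_le (hf : Submodular₂ f) (d : V → ℕ) (T : Finset V) :
    delayGain f d T ≤ f T T - f ∅ ∅ := by
  have hd := delay_le_sup d
  let ψ : ℕ → ℝ := fun i => f (revealed d i ∅ ∩ T) (revealed (fun v => d v + 1) i ∅ ∩ T)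
  have hstep : ∀ i, stageValue f d i T - stageValue f d i ∅ ≤ ψ (i + 1) - ψ i := by
    intro i
    rw [sub_le_sub_iff]
    refine le_trans (le_of_eq ?_) ((hf (revealed d (i + 1) ∅ ∩ T) (revealed d i ∅)
      (revealed (fun v => d v + 1) (i + 1) ∅ ∩ T) (revealed (fun v => d v + 1) i ∅)))
    unfold stageValue
    simp only [ψ]
    congr 2 <;> ext v <;> simp only [mem_revealed, Finset.mem_union, Finset.mem_inter] <;> grind
  rw [delayGain, stageGain]
  refine (Finset.sum_le_sum fun i _ => hstep i).trans (le_of_eq ?_)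
  rw [Finset.sum_range_sub ψ]
  simp only [ψ]
  congr 2 <;> ext v <;> simp only [mem_revealed, Finset.mem_inter] <;> have := hd v <;> grind

theorem delayGain_split_of_gap {d : V → ℕ} {j : ℕ} (hj : ∀ v, d v ≠ j) (S : Finset V) :
    delayGain f d S = delayGain f d (S ∩ univ.filter (fun v => d v < j)) +
      delayGain f d (S \ univ.filter (fun v => d v < j)) := by
  unfold delayGain stageGain
  rw [← Finset.sum_add_distrib]
  refine Finset.sum_congr rfl fun i _ => ?_
  set T : Finset V := univ.filter (fun v => d v < j) with hT
  have hmem : ∀ v, v ∈ T ↔ d v < j := by simp [hT]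
  rcases le_or_gt i j with h | h
  · have h1 : stageValue f d i (S ∩ T) = stageValue f d i S := by
      unfold stageValue
      congr 1 <;> ext v <;> simp only [mem_revealed, Finset.mem_inter, hmem] <;>
        have := hj v <;> grind
    have h2 : stageValue f d i (S \ T) = stageValue f d i ∅ := by
      unfold stageValue
      congr 1 <;> ext v <;> simp only [mem_revealed, Finset.mem_sdiff, hmem] <;>
        have := hj v <;> grind
    rw [h1, h2, sub_self, add_zero]
  · have h1 : stageValue f d i (S ∩ T) = stageValue f d i ∅ := by
      unfold stageValue
      congr 1 <;> ext v <;> simp only [mem_revealed, Finset.mem_inter, hmem] <;>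
        have := hj v <;> grind
    have h2 : stageValue f d i (S \ T) = stageValue f d i S := by
      unfold stageValue
      congr 1 <;> ext v <;> simp only [mem_revealed, Finset.mem_sdiff, hmem] <;>
        have := hj v <;> grind
    rw [h1, h2, sub_self, zero_add]

/-- Removing an empty layer does not decrease the gain. -/
theorem delayGain_le_of_gap (hf : Submodular₂ f) {d : V → ℕ} {j : ℕ} (hj : ∀ v, d v ≠ j)
    (S : Finset V) :
    delayGain f d S ≤ delayGain f (fun v => if d v < j then d v else d v - 1) S := by
  set T : Finset V := univ.filter (fun v => d v < j) with hT
  have hmem : ∀ v, v ∈ T ↔ d v < j := by simp [hT]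
  have h := delayGain_shift_ge hf d Tᶜ S
  have hfun : (fun v => if v ∈ Tᶜ then d v else d v + 1) =
      fun v => (if d v < j then d v else d v - 1) + 1 := by
    funext v
    have := hj v
    simp only [Finset.mem_compl, hmem]
    split_ifs <;> omega
  rw [hfun, delayGain_add_one, delayGain_split_of_gap hj (S ∪ Tᶜ), ← hT] at h
  have e1 : (S ∪ Tᶜ) ∩ T = S ∩ T := by ext v; simp; tauto
  have e2 : (S ∪ Tᶜ) \ T = Tᶜ := by ext v; simp; tauto
  have e3 : S ∩ Tᶜ = S \ T := by ext v; simp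
  rw [e1, e2, e3] at h
  rw [delayGain_split_of_gap hj S, ← hT]
  linarith

/-- Every layer below a nonempty one is nonempty. -/
def Gapless {V : Type*} (d : V → ℕ) : Prop := ∀ j v, j < d v → ∃ u, d u = j

theorem Gapless.lt_card {V : Type*} [Fintype V] {d : V → ℕ} (hd : Gapless d) (v : V) : d v < Fintype.card V := by
  have hsub : range (d v + 1) ⊆ univ.image d := by
    intro j hj
    rcases (Nat.lt_succ_iff.1 (Finset.mem_range.1 hj)).lt_or_eq with h | h
    · obtain ⟨u, hu⟩ := hd j v h
      exact Finset.mem_image.2 ⟨u, mem_univ u, hu⟩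
    · exact Finset.mem_image.2 ⟨v, mem_univ v, h.symm⟩
  simpa using (Finset.card_le_card hsub).trans Finset.card_image_le

theorem exists_gapless_delayGain_ge (hf : Submodular₂ f) (d : V → ℕ) :
    ∃ d' : V → ℕ, Gapless d' ∧ ∀ S, delayGain f d S ≤ delayGain f d' S := by
  induction h : ∑ v, d v using Nat.strong_induction_on generalizing d with
  | _ n ih =>
    by_cases hd : Gapless d
    · exact ⟨d, hd, fun S => le_rfl⟩
    · simp only [Gapless, not_forall, not_exists] at hd
      obtain ⟨j, v, hv, hj⟩ := hd
      obtain ⟨d', h1, h2⟩ := ih _ (by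
        rw [← h]
        refine Finset.sum_lt_sum (fun u _ => ?_) ⟨v, mem_univ v, ?_⟩
        · split_ifs <;> omega
        · split_ifs <;> omega) (fun v => if d v < j then d v else d v - 1) rfl
      exact ⟨d', h1, fun S => (delayGain_le_of_gap hf hj S).trans (h2 S)⟩

theorem exists_optimal_delay (hf : Submodular₂ f) (ρ : Finset V → ℝ) :
    ∃ m : ℝ, (∃ d : V → ℕ, ∀ S, m ≤ delayGain f d S - ρ S) ∧
      ∀ d : V → ℕ, ∃ S, delayGain f d S - ρ S ≤ m := by
  let M : (V → ℕ) → ℝ := fun d => univ.inf' univ_nonempty fun S => delayGain f d S - ρ S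
  obtain ⟨d₀, -, h₀⟩ := Finset.exists_max_image
    (Fintype.piFinset fun _ : V => range (Fintype.card V + 1)) M ⟨fun _ => 0, by simp⟩
  refine ⟨M d₀, ⟨d₀, fun S => Finset.inf'_le _ (mem_univ S)⟩, fun d => ?_⟩
  obtain ⟨d', hd', hle⟩ := exists_gapless_delayGain_ge hf d
  have hM : M d' ≤ M d₀ := h₀ d' (Fintype.mem_piFinset.2 fun v =>
    Finset.mem_range.2 ((hd'.lt_card v).trans (Nat.lt_succ_self _)))
  obtain ⟨S, -, hS⟩ := Finset.exists_mem_eq_inf' (univ_nonempty (α := Finset V))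
    fun S => delayGain f d' S - ρ S
  exact ⟨S, (sub_le_sub_right (hle S) _).trans (hS.symm.le.trans hM)⟩

theorem exists_gapless_le_delayGain (hf : Submodular₂ f) (ρ : Finset V → ℝ)
    (hρ : ∀ S T, ρ (S ∩ T) + ρ (S ∪ T) = ρ S + ρ T) (h : ∀ T, ρ T ≤ f T T - f ∅ ∅) :
    ∃ d : V → ℕ, Gapless d ∧ ∀ S, ρ S ≤ delayGain f d S := by
  obtain ⟨m, ⟨d₀, hd₀⟩, hm⟩ := exists_optimal_delay hf ρ
  suffices hm0 : 0 ≤ m by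
    obtain ⟨d, hd, hle⟩ := exists_gapless_delayGain_ge hf d₀
    exact ⟨d, hd, fun S => by linarith [hle S, hd₀ S]⟩
  by_contra! hneg
  let Good : (V → ℕ) → Finset V → Prop := fun d T =>
    (∀ S, m ≤ delayGain f d S - ρ S) ∧ Maximal (fun S => delayGain f d S - ρ S = m) T
  have hex : ∀ d : V → ℕ, (∀ S, m ≤ delayGain f d S - ρ S) → ∃ T, Good d T := by
    intro d hd
    obtain ⟨S, hS⟩ := hm d
    obtain ⟨T, -, hT⟩ := (Set.toFinite {S | delayGain f d S - ρ S = m}).exists_le_maximal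
      (show S ∈ {S | delayGain f d S - ρ S = m} from le_antisymm hS (hd S))
    exact ⟨T, hd, hT⟩
  obtain ⟨T₀, hT₀⟩ := hex d₀ hd₀
  obtain ⟨⟨d, T⟩, hgood, hmin⟩ := exists_minimalFor_of_wellFoundedLT
    (fun x : (V → ℕ) × Finset V => Good x.1 x.2) (fun x => x.2.card) ⟨(d₀, T₀), hT₀⟩
  have hstep : ∀ d : V → ℕ, Good d T → Good (fun v => if v ∈ T then d v else d v + 1) T := by
    intro d hd
    have hge : ∀ S, (delayGain f d (S ∩ T) - ρ (S ∩ T)) + (delayGain f d (S ∪ T) - ρ (S ∪ T)) - m ≤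
        delayGain f (fun v => if v ∈ T then d v else d v + 1) S - ρ S := by
      intro S
      linarith [delayGain_shift_ge hf d T S, hρ S T, hd.2.prop]
    obtain ⟨T', hT'⟩ := hex _ fun S => by linarith [hge S, hd.1 (S ∩ T), hd.1 (S ∪ T)]
    have hsub : T' ⊆ T := by
      have hmem : delayGain f d (T' ∪ T) - ρ (T' ∪ T) = m := by
        linarith [hge T', hd.1 (T' ∩ T), hd.1 (T' ∪ T), hT'.2.prop]
      exact Finset.subset_union_left.trans (hd.2.le_of_ge hmem Finset.subset_union_right)
    have hcard : T.card ≤ T'.card := by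
      by_contra! hlt
      exact absurd (hmin (j := (_, T')) hT' hlt.le) (not_le.2 hlt)
    rwa [Finset.eq_of_subset_of_card_le hsub hcard] at hT'
  have hiter : ∀ k : ℕ, Good (fun v => if v ∈ T then d v else d v + k) T := by
    intro k
    induction k with
    | zero => simpa using hgood
    | succ k ih =>
      convert hstep _ ih using 2 with v
      split_ifs <;> omega
  have hlast := (hiter (univ.sup d + 3)).2.prop
  rw [delayGain_of_separated (univ.sup d + 2)
    (fun v hv => by have := delay_le_sup d v; simp only [hv, if_true]; omega)
    (fun v hv => by simp only [hv, if_false]; omega)] at hlast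
  linarith [h T]

end Delay

section Layers

variable {Ω V γ : Type*} [Fintype Ω] [Fintype V] [DecidableEq V]
  {α β : V → Type*} [∀ v, Fintype (α v)] [∀ v, DecidableEq (α v)]
  [∀ v, Fintype (β v)] [∀ v, DecidableEq (β v)] [Fintype γ] [DecidableEq γ]

theorem mem_lowUnion_iff {V : Type*} [DecidableEq V] {d : V → ℕ} {L : ℕ → Finset V} (hL : ∀ i v, v ∈ L i ↔ d v + 1 = i)
    (i : ℕ) (v : V) : v ∈ lowUnion L i ↔ d v + 1 < i := by
  simp [lowUnion, hL]

theorem layerCondEnt_eq (p : Ω → ℝ) (X : ∀ v, Ω → α v) (Y : ∀ v, Ω → β v) (Z : Ω → γ)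
    {d : V → ℕ} {K : ℕ} {L : ℕ → Finset V} (hL : ∀ i v, v ∈ L i ↔ d v + 1 = i)
    (hK : ∀ v, d v + 1 ≤ K) (S : Finset V) :
    layerCondEnt p X Y Z K L S = delayGain (jointEnt p X Y Z) d univ -
      delayGain (jointEnt p X Y Z) d Sᶜ := by
  have hlow := mem_lowUnion_iff hL
  rw [delayGain_eq_stageGain (N := K + 1) (fun v => by have := hK v; omega),
    delayGain_eq_stageGain (N := K + 1) (fun v => by have := hK v; omega),
    stageGain, stageGain, ← Finset.sum_sub_distrib, layerCondEnt]
  refine Finset.sum_nbij' (· - 1) (· + 1) ?_ ?_ ?_ ?_ ?_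
  · intro i hi; simp only [Finset.mem_Icc, Finset.mem_range] at *; omega
  · intro i hi; simp only [Finset.mem_Icc, Finset.mem_range] at *; omega
  · intro i hi; simp only [Finset.mem_Icc] at *; omega
  · intro i _; simp
  · intro i hi
    obtain ⟨i, rfl⟩ : ∃ j, i = j + 1 := ⟨i - 1, by simp only [Finset.mem_Icc] at hi; omega⟩
    rw [ce_eq_jointEnt_sub, Nat.add_sub_cancel, sub_sub_sub_cancel_right]
    unfold stageValue
    congr 2 <;> ext v <;> simp only [mem_revealed, Finset.mem_union, Finset.mem_inter,
      Finset.mem_sdiff, Finset.mem_compl, hL, hlow, mem_univ] <;> grind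

theorem IsOrdPart.exists_delay {K : ℕ} {L : ℕ → Finset V} (h : IsOrdPart K L) :
    ∃ d : V → ℕ, (∀ i v, v ∈ L i ↔ d v + 1 = i) ∧ ∀ v, d v + 1 ≤ K := by
  obtain ⟨-, hempty, hdisj, hcover⟩ := h
  have hex : ∀ v, ∃ i, i + 1 ≤ K ∧ v ∈ L (i + 1) := by
    intro v
    have hv : v ∈ (range (K + 1)).biUnion L := hcover ▸ mem_univ v
    obtain ⟨i, hi, hvi⟩ := Finset.mem_biUnion.1 hv
    cases i with
    | zero => simp [hempty 0 (Or.inl rfl)] at hvi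
    | succ i => exact ⟨i, Nat.lt_succ_iff.1 (Finset.mem_range.1 hi), hvi⟩
  choose d hd hmem using hex
  refine ⟨d, fun i v => ⟨fun hv => ?_, fun hi => hi ▸ hmem v⟩, hd⟩
  by_contra hne
  exact Finset.disjoint_left.1 (hdisj _ _ hne) (hmem v) hv

theorem Gapless.isOrdPart {d : V → ℕ} (hd : Gapless d) :
    IsOrdPart (univ.sup fun v => d v + 1) (fun i => univ.filter fun v => d v + 1 = i) := by
  have hle : ∀ v, d v + 1 ≤ univ.sup fun v => d v + 1 := delay_le_sup _
  refine ⟨fun i hi hiK => ?_, fun i hi => ?_, fun i j hij => ?_, ?_⟩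
  · obtain ⟨v, -, hv⟩ := (Finset.lt_sup_iff (a := i - 1)).1
      (show i - 1 < univ.sup fun v => d v + 1 by omega)
    rcases (Nat.lt_succ_iff.1 hv).lt_or_eq with h | h
    · obtain ⟨u, hu⟩ := hd _ v h
      exact ⟨u, by simp; omega⟩
    · exact ⟨v, by simp; omega⟩
  · refine Finset.filter_eq_empty_iff.2 fun v _ => ?_
    have := hle v
    omega
  · refine Finset.disjoint_left.2 fun v hv hv' => hij ?_
    simp only [Finset.mem_filter, mem_univ, true_and] at hv hv'
    omega
  · ext v
    have := hle v
    simp only [Finset.mem_biUnion, Finset.mem_range, Finset.mem_filter, mem_univ, true_and,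
      iff_true]
    exact ⟨d v + 1, by omega, rfl⟩

end Layers

/-- The SW-identity: the union over all ordered partitions `C` of `V` of the layered
Slepian-Wolf regions `R_C` equals the joint Slepian-Wolf region `R_SW`: a rate vector
`R` satisfies `R_S ≥ H(X_S Y_S | X_{Sᶜ} Y_{Sᶜ} Z)` for all `S ⊆ V` iff there is an
ordered partition `C = [L₁,…,L_K]` with
`R_S ≥ Σ_{i=1}^{K+1} H(X_{S∩L_i} Y_{S∩L_{i−1}} | X_{L_i∖S} Y_{L_{i−1}∖S} X_{L^i} Y_{L^{i−1}} Z)`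
for all `S ⊆ V`. -/
theorem SW_identity {Ω V γ : Type*} [Fintype Ω] [Fintype V] [DecidableEq V]
    {α β : V → Type*} [∀ v, Fintype (α v)] [∀ v, DecidableEq (α v)]
    [∀ v, Fintype (β v)] [∀ v, DecidableEq (β v)] [Fintype γ] [DecidableEq γ]
    (p : Ω → ℝ) (hp0 : ∀ ω, 0 ≤ p ω) (hp1 : ∑ ω, p ω = 1)
    (X : ∀ v, Ω → α v) (Y : ∀ v, Ω → β v) (Z : Ω → γ) (R : V → ℝ) :
    (∀ S : Finset V, ce p X Y Z S S Sᶜ Sᶜ ≤ ∑ v ∈ S, R v) ↔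
      (∃ (K : ℕ) (L : ℕ → Finset V), IsOrdPart K L ∧
        ∀ S : Finset V, layerCondEnt p X Y Z K L S ≤ ∑ v ∈ S, R v) := by
  have hf : Submodular₂ (jointEnt p X Y Z) := jointEnt_submodular hp0 X Y Z
  have hSW : ∀ S : Finset V, ce p X Y Z S S Sᶜ Sᶜ =
      jointEnt p X Y Z univ univ - jointEnt p X Y Z Sᶜ Sᶜ := by
    intro S
    rw [ce_eq_jointEnt_sub, Finset.union_compl]
  constructor
  · intro h
    obtain ⟨d, hd, hle⟩ := exists_gapless_le_delayGain hf
      (fun S => jointEnt p X Y Z univ univ - jointEnt p X Y Z ∅ ∅ - ∑ v, R v + ∑ v ∈ S, R v)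
      (fun S T => by linarith [Finset.sum_union_inter (s₁ := S) (s₂ := T) (f := R)])
      (fun T => by
        have hT := h Tᶜ
        rw [hSW, compl_compl] at hT
        linarith [Finset.sum_add_sum_compl T R])
    refine ⟨_, _, hd.isOrdPart, fun S => ?_⟩
    rw [layerCondEnt_eq p X Y Z (d := d) (by simp)
      (fun v => delay_le_sup (fun v => d v + 1) v), delayGain_univ]
    linarith [hle Sᶜ, Finset.sum_add_sum_compl S R]
  · rintro ⟨K, L, hKL, h⟩ S
    obtain ⟨d, hL, hK⟩ := hKL.exists_delay
    have hS := h S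
    rw [layerCondEnt_eq p X Y Z hL hK, delayGain_univ] at hS
    rw [hSW]
    linarith [delayGain_le hf d Sᶜ]
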